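/- Let $G=(V,\mathcal E)$ be a finite connected undirected graph without loops or multiple edges, and let $\mathcal A$ be its set of arcs, consisting of both orientations of each edge; write $r(a)$ for the reversal of an arc $a$. A cycle is a closed trajectory $\omega=v_0v_1\cdots v_{n-1}v_0$ of $(V,\mathcal A)$, taken up to rotation, with $v_0,\dots,v_{n-1}$ pairwise distinct and $n\ge 3$ (going forth and back along a single edge does not count as a cycle). Its cycle vector $z(\omega)\in\{-1,0,1\}^{\mathcal A}$ has $z_a(\omega)=+1$ if $a$ is an arc of $\omega$, $z_a(\omega)=-1$ if $r(a)$ is an arc of $\omega$, and $z_a(\omega)=0$ otherwise. Let $\mathbb Z(\mathcal A)$ be the set of integer vectors in the real linear span of the cycle vectors in $\mathbb R^{\mathcal A}$. Then the set of cycle vectors $\{z(\omega):\omega \text{ a cycle}\}$ is the Graver basis of $\mathbb Z(\mathcal A)$: it equals the set of nonzero elements $z$ of $\mathbb Z(\mathcal A)$ that are minimal with respect to the conformality order, i.e. such that the only nonzero $z'\in\mathbb Z(\mathcal A)$ with $z'_a z_a\ge 0$ and $|z'_a|\le |z_a|$ for all $a\in\mathcal A$ is $z$ itself. -/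

import Mathlib

/-- The cycle vector `z(ω) ∈ ℤ^𝒜` of a closed walk `ω`: `+1` on the arcs of `ω`, `-1` on the arcs
whose reversal is an arc of `ω`, and `0` elsewhere. The arcs of a graph are its darts, i.e. both
orientations of each edge. It is used for cycles, `ω.IsCycle`, which never traverse both
orientations of an edge, so that the first two cases exclude each other. -/
def cycleVector {V : Type*} [DecidableEq V] {G : SimpleGraph V} {v : V} (ω : G.Walk v v) :
    G.Dart → ℤ :=
  fun a => if a ∈ ω.darts then 1 else if a.symm ∈ ω.darts then -1 else 0

/-- The cycle vector depends only on the cycle up to rotation, not on its initial vertex. -/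
theorem cycleVector_rotate {V : Type*} [DecidableEq V] {G : SimpleGraph V} {v w : V}
    (ω : G.Walk v v) (h : w ∈ ω.support) : cycleVector (ω.rotate w h) = cycleVector ω := by
  funext a
  simp only [cycleVector, (ω.rotate_darts w h).mem_iff]

/-- The set `{z(ω) : ω a cycle}`. A cycle is a closed walk that meets no vertex twice except for the
initial one, which is met again at the end, and that uses no edge twice: it has length at least 3,
and going forth and back along one edge is not a cycle. -/
def cycleVectors {V : Type*} [DecidableEq V] (G : SimpleGraph V) : Set (G.Dart → ℤ) :=
  {z | ∃ (v : V) (ω : G.Walk v v), ω.IsCycle ∧ z = cycleVector ω}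

/-- The cycle space: the real linear span of the cycle vectors in `ℝ^𝒜`. -/
def cycleSpace {V : Type*} [DecidableEq V] (G : SimpleGraph V) : Submodule ℝ (G.Dart → ℝ) :=
  Submodule.span ℝ {x | ∃ z ∈ cycleVectors G, x = fun a => (z a : ℝ)}

/-- `ℤ(𝒜)`: the lattice of the integer vectors in the cycle space. -/
def cycleLattice {V : Type*} [DecidableEq V] (G : SimpleGraph V) : AddSubgroup (G.Dart → ℤ) where
  carrier := {z | (fun a => (z a : ℝ)) ∈ cycleSpace G}
  zero_mem' := by
    have h := (cycleSpace G).zero_mem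
    simpa [Pi.zero_def] using h
  add_mem' := by
    intro x y hx hy
    have h := (cycleSpace G).add_mem hx hy
    simpa [Pi.add_def] using h
  neg_mem' := by
    intro x hx
    have h := (cycleSpace G).neg_mem hx
    simpa [Pi.neg_def] using h

/-- `z₁ ⊑ z₂`: `z₁` is conformal to `z₂`. -/
def IsConformalTo {ι : Type*} (z₁ z₂ : ι → ℤ) : Prop :=
  ∀ a, 0 ≤ z₁ a * z₂ a ∧ |z₁ a| ≤ |z₂ a|

/-- The Graver basis of a lattice: its nonzero elements that are minimal, among the nonzero
elements, for the conformality order. -/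
def graverBasis {ι : Type*} (L : AddSubgroup (ι → ℤ)) : Set (ι → ℤ) :=
  {z | z ∈ L ∧ z ≠ 0 ∧ ∀ z' ∈ L, z' ≠ 0 → IsConformalTo z' z → z' = z}

namespace SimpleGraph

variable {V : Type*} {G : SimpleGraph V}

theorem Walk.IsTrail.symm_notMem_darts {u v : V} {p : G.Walk u v} (hp : p.IsTrail) {d : G.Dart}
    (hd : d ∈ p.darts) : d.symm ∉ p.darts := fun hs =>
  d.symm_ne (List.inj_on_of_nodup_map hp.edges_nodup hs hd d.edge_symm)

theorem Walk.IsCycle.dart_ext_snd {v : V} {p : G.Walk v v} (hp : p.IsCycle) {d e : G.Dart}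
    (hd : d ∈ p.darts) (he : e ∈ p.darts) (h : d.snd = e.snd) : d = e := by
  have hn := hp.support_nodup
  rw [← p.map_snd_darts] at hn
  exact List.inj_on_of_nodup_map hn hd he h

theorem Walk.IsCycle.dart_ext_fst {v : V} {p : G.Walk v v} (hp : p.IsCycle) {d e : G.Dart}
    (hd : d ∈ p.darts) (he : e ∈ p.darts) (h : d.fst = e.fst) : d = e := by
  have hr : p.reverse.IsCycle := hp.reverse
  have := hr.dart_ext_snd (d := d.symm) (e := e.symm) (by simpa [Walk.darts_reverse] using hd)
    (by simpa [Walk.darts_reverse] using he) h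
  simpa using congrArg Dart.symm this

variable [DecidableEq V]

/-- A circulation: an antisymmetric function on the arcs that satisfies flow conservation at each
vertex. -/
def IsCirculation [Fintype G.Dart] {R : Type*} [AddCommGroup R] (z : G.Dart → R) : Prop :=
  (∀ a, z a.symm = -z a) ∧ ∀ v, ∑ a with a.fst = v, z a = 0

/-- The signed indicator of the arcs of a walk. On closed walks this is `cycleVector`. -/
def walkVector {u v : V} (p : G.Walk u v) : G.Dart → ℤ :=
  fun a => if a ∈ p.darts then 1 else if a.symm ∈ p.darts then -1 else 0

theorem walkVector_cons {u v w : V} (h : G.Adj u v) {p : G.Walk v w}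
    (hp : (Walk.cons h p).IsTrail) (a : G.Dart) :
    walkVector (Walk.cons h p) a = walkVector p a +
      ((if a = ⟨(u, v), h⟩ then 1 else 0) - if a = ⟨(v, u), h.symm⟩ then 1 else 0) := by
  have hs : a.symm = ⟨(u, v), h⟩ ↔ a = ⟨(v, u), h.symm⟩ :=
    ⟨fun e => by simpa using congrArg Dart.symm e, fun e => by rw [e]; rfl⟩
  have hne : u ≠ v := h.ne
  have he := ((Walk.isTrail_cons h p).1 hp).2
  have h1 : (⟨(u, v), h⟩ : G.Dart) ∉ p.darts := fun hm => he (List.mem_map_of_mem hm)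
  have h2 : (⟨(v, u), h.symm⟩ : G.Dart) ∉ p.darts := fun hm =>
    he (Sym2.eq_swap ▸ List.mem_map_of_mem (f := Dart.edge) hm)
  simp only [walkVector, Walk.darts_cons, List.mem_cons, hs]
  by_cases ha : a = ⟨(u, v), h⟩
  · subst ha
    simp [h1, h2, hne, Dart.symm]
  by_cases hb : a = ⟨(v, u), h.symm⟩
  · subst hb
    simp [h1, h2, hne.symm, Dart.symm]
  simp [ha, hb]

theorem sum_walkVector [Fintype G.Dart] (x : V) {u v : V} (p : G.Walk u v) (hp : p.IsTrail) :
    ∑ a with a.fst = x, walkVector p a = (if u = x then 1 else 0) - if v = x then 1 else 0 := by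
  induction p with
  | nil => simp [walkVector]
  | cons h p ih =>
    simp only [walkVector_cons h hp, Finset.sum_add_distrib, ih ((Walk.isTrail_cons h p).1 hp).1,
      Finset.sum_sub_distrib, Finset.sum_ite_eq', Finset.mem_filter_univ]
    ring

theorem isCirculation_cycleVector [Fintype G.Dart] {v : V} {p : G.Walk v v} (hp : p.IsCycle) :
    IsCirculation (cycleVector p) := by
  refine ⟨fun a => ?_, fun x => (sum_walkVector x p hp.isTrail).trans (sub_self _)⟩
  have := hp.isTrail.symm_notMem_darts (d := a)
  simp only [cycleVector, Dart.symm_symm]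
  split_ifs <;> simp_all

theorem isCirculation_of_mem_cycleLattice [Fintype G.Dart] {z : G.Dart → ℤ}
    (hz : z ∈ cycleLattice G) : IsCirculation z := by
  have hz' : (fun a => (z a : ℝ)) ∈ cycleSpace G := hz
  have key : IsCirculation (fun a => (z a : ℝ)) := by
    refine Submodule.span_induction (p := fun x _ => IsCirculation x) ?_ ?_ ?_ ?_ hz'
    · rintro _ ⟨_, ⟨v, p, hp, rfl⟩, rfl⟩
      have hc := isCirculation_cycleVector hp
      refine ⟨fun a => ?_, fun v => ?_⟩
      · beta_reduce
        exact_mod_cast hc.1 a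
      · beta_reduce
        exact_mod_cast hc.2 v
    · exact ⟨by simp, by simp⟩
    · intro x y _ _ hx hy
      refine ⟨fun a => ?_, fun v => ?_⟩
      · rw [Pi.add_apply, hx.1, hy.1, Pi.add_apply]; abel
      · simp only [Pi.add_apply, Finset.sum_add_distrib, hx.2, hy.2, add_zero]
    · intro c x _ hx
      refine ⟨fun a => ?_, fun v => ?_⟩
      · simp [hx.1]
      · simp only [Pi.smul_apply, ← Finset.smul_sum, hx.2, smul_zero]
  refine ⟨fun a => ?_, fun v => ?_⟩
  · have := key.1 a
    beta_reduce at this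
    exact_mod_cast this
  · have := key.2 v
    beta_reduce at this
    exact_mod_cast this

theorem IsCirculation.exists_pos_in [Fintype G.Dart] {z : G.Dart → ℤ} (hz : IsCirculation z)
    {d : G.Dart} (hd : 0 < z d) : ∃ e : G.Dart, 0 < z e ∧ e.snd = d.fst := by
  obtain ⟨e, he, hneg⟩ : ∃ e ∈ Finset.univ.filter (fun a : G.Dart => a.fst = d.fst), z e < 0 := by
    by_contra! h
    have := (Finset.sum_eq_zero_iff_of_nonneg h).1 (hz.2 d.fst) d (by simp)
    omega
  exact ⟨e.symm, by rw [hz.1]; omega, by simpa using he⟩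

/-- A nonzero circulation is positive on all arcs of some cycle. -/
theorem IsCirculation.exists_isCycle_pos [Finite V] [Fintype G.Dart] {z : G.Dart → ℤ}
    (hz : IsCirculation z) (h0 : z ≠ 0) :
    ∃ (v : V) (p : G.Walk v v), p.IsCycle ∧ ∀ d ∈ p.darts, 0 < z d := by
  by_contra! hno
  have key : ∀ n : ℕ, ∃ (u v : V) (p : G.Walk u v), p.IsPath ∧ (∀ d ∈ p.darts, 0 < z d) ∧
      p.length = n ∧ ∃ e : G.Dart, 0 < z e ∧ e.snd = u := by
    intro n
    induction n with
    | zero =>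
      obtain ⟨d, hd⟩ : ∃ d, 0 < z d := by
        obtain ⟨d, hd⟩ := Function.ne_iff.1 h0
        rcases lt_or_gt_of_ne hd with h | h
        · exact ⟨d.symm, by rw [hz.1]; simpa using h⟩
        · exact ⟨d, h⟩
      exact ⟨d.snd, d.snd, .nil, .nil, by simp, rfl, d, hd, rfl⟩
    | succ n ih =>
      obtain ⟨u, v, p, hp, hpos, hlen, e, he, rfl⟩ := ih
      by_cases hmem : e.fst ∈ p.support
      · exfalso
        have hq := hp.takeUntil hmem
        have hqpos : ∀ d ∈ (p.takeUntil e.fst hmem).darts, 0 < z d := fun d hd =>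
          hpos d (p.darts_takeUntil_subset_darts hmem hd)
        generalize p.takeUntil e.fst hmem = q at hq hqpos
        have hcyc : (Walk.cons e.adj q).IsCycle := by
          refine (Walk.cons_isCycle_iff q e.adj).2 ⟨hq, fun hedge => ?_⟩
          obtain ⟨d, hd, hde⟩ := List.mem_map.1 hedge
          rcases dart_edge_eq_iff d e |>.1 hde with rfl | rfl
          · have : d.snd ∈ q.support.tail := by
              rw [← q.map_snd_darts]; exact List.mem_map_of_mem hd
            have hn := hq.support_nodup
            rw [← q.cons_tail_support] at hn
            exact (List.nodup_cons.1 hn).1 this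
          · have := hqpos _ hd
            rw [hz.1] at this
            omega
        obtain ⟨d, hd, hle⟩ := hno _ _ hcyc
        rcases List.mem_cons.1 hd with rfl | hd
        · exact absurd he hle.not_gt
        · exact absurd (hqpos d hd) hle.not_gt
      · obtain ⟨e', he', hee⟩ := hz.exists_pos_in he
        refine ⟨e.fst, v, .cons e.adj p, hp.cons hmem, ?_, by simp [hlen], e', he', hee⟩
        intro d hd
        rcases List.mem_cons.1 hd with rfl | hd
        · exact he
        · exact hpos d hd
  have := Fintype.ofFinite V
  obtain ⟨u, v, p, hp, -, hlen, -⟩ := key (Fintype.card V)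
  exact absurd hp.length_lt hlen.not_lt

theorem cycleVector_mem_cycleLattice {v : V} {p : G.Walk v v} (hp : p.IsCycle) :
    cycleVector p ∈ cycleLattice G :=
  Submodule.subset_span ⟨_, ⟨v, p, hp, rfl⟩, rfl⟩

theorem cycleVector_ne_zero {v : V} {p : G.Walk v v} (hp : p.IsCycle) : cycleVector p ≠ 0 := by
  intro h
  obtain ⟨d, hd⟩ := List.exists_mem_of_ne_nil p.darts (by
    simpa [Walk.darts_eq_nil] using hp.not_nil)
  simpa [cycleVector, hd] using congrFun h d

theorem isConformalTo_cycleVector [Fintype G.Dart] {z : G.Dart → ℤ} (hz : IsCirculation z)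
    {v : V} {p : G.Walk v v} (hpos : ∀ d ∈ p.darts, 0 < z d) :
    IsConformalTo (cycleVector p) z := by
  intro a
  have h1 := hpos a
  have h2 := hpos a.symm
  rw [hz.1] at h2
  simp only [cycleVector]
  split_ifs with h h'
  · have := h1 h
    simp only [one_mul, abs_one]
    exact ⟨this.le, by rw [abs_of_pos this]; omega⟩
  · have := h2 h'
    simp only [neg_mul, one_mul, abs_neg, abs_one]
    exact ⟨this.le, by rw [abs_of_neg (by omega)]; omega⟩
  · simp

/-- A circulation supported on a cycle takes the same value on all arcs of the cycle. -/
theorem IsCirculation.eq_on_isCycle [Fintype G.Dart] {z : G.Dart → ℤ} (hz : IsCirculation z)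
    {v : V} {p : G.Walk v v} (hp : p.IsCycle)
    (hsupp : ∀ a, a ∉ p.darts → a.symm ∉ p.darts → z a = 0) {d e : G.Dart}
    (hd : d ∈ p.darts) (he : e ∈ p.darts) : z d = z e := by
  have step : ∀ d ∈ p.darts, ∀ e ∈ p.darts, d.snd = e.fst → z d = z e := by
    intro d hd e he hde
    have hne : e ≠ d.symm := fun h => hp.isTrail.symm_notMem_darts hd (h ▸ he)
    have hsum := hz.2 e.fst
    rw [Finset.sum_eq_add_of_mem e d.symm (by simp) (by simpa using hde) hne, hz.1] at hsum
    · omega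
    · rintro a ha ⟨hae, had⟩
      have ha' : a.fst = e.fst := by simpa using ha
      refine hsupp a (fun h => hae (hp.dart_ext_fst h he ha')) fun h => had ?_
      have := hp.dart_ext_snd h hd (ha'.trans hde.symm)
      rw [← this, Dart.symm_symm]
  have hchain : p.darts.IsChain (fun d e => z d = z e) :=
    List.isChain_iff_getElem.2 fun i hi => step _ (List.getElem_mem _) _ (List.getElem_mem _)
      (List.isChain_iff_getElem.1 p.isChain_dartAdj_darts i hi)
  have : IsTrans G.Dart (fun d e => z d = z e) := ⟨fun _ _ _ => Eq.trans⟩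
  have : Std.Symm (fun d e : G.Dart => z d = z e) := ⟨fun _ _ => Eq.symm⟩
  exact List.Pairwise.forall_of_forall (R := fun d e => z d = z e) (fun _ _ => rfl)
    hchain.pairwise hd he

theorem eq_cycleVector_of_isConformalTo [Fintype G.Dart] {z : G.Dart → ℤ} (hz : IsCirculation z)
    (h0 : z ≠ 0) {v : V} {p : G.Walk v v} (hp : p.IsCycle)
    (hc : IsConformalTo z (cycleVector p)) : z = cycleVector p := by
  have hsupp : ∀ a, a ∉ p.darts → a.symm ∉ p.darts → z a = 0 := by
    intro a h h'
    simpa [cycleVector, h, h'] using (hc a).2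
  obtain ⟨e, he, hze⟩ : ∃ e ∈ p.darts, z e ≠ 0 := by
    by_contra! h
    refine h0 (funext fun a => ?_)
    by_cases h1 : a ∈ p.darts
    · exact h a h1
    by_cases h2 : a.symm ∈ p.darts
    · simpa [hz.1] using h _ h2
    · exact hsupp a h1 h2
  have hone : ∀ d ∈ p.darts, z d = 1 := by
    intro d hd
    rw [hz.eq_on_isCycle hp hsupp hd he]
    have := hc e
    simp only [cycleVector, he, if_true, mul_one, abs_one, abs_le] at this
    omega
  funext a
  simp only [cycleVector]
  split_ifs with h h'
  · exact hone a h
  · have := hone _ h'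
    rw [hz.1] at this
    omega
  · exact hsupp a h h'

end SimpleGraph

open SimpleGraph in
/-- The set of cycle vectors of a finite connected graph without loops is the Graver basis of the
lattice of integer vectors in the cycle space. -/
theorem stmt13 {V : Type*} [Finite V] [DecidableEq V] (G : SimpleGraph V) (hG : G.Connected) :
    cycleVectors G = graverBasis (cycleLattice G) := by
  classical
  have := Fintype.ofFinite V
  ext z
  constructor
  · rintro ⟨v, p, hp, rfl⟩
    exact ⟨cycleVector_mem_cycleLattice hp, cycleVector_ne_zero hp, fun z' hz' h0 hc =>
      eq_cycleVector_of_isConformalTo (isCirculation_of_mem_cycleLattice hz') h0 hp hc⟩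
  · rintro ⟨hz, h0, hmin⟩
    have hcirc := isCirculation_of_mem_cycleLattice hz
    obtain ⟨v, p, hp, hpos⟩ := hcirc.exists_isCycle_pos h0
    exact ⟨v, p, hp, (hmin _ (cycleVector_mem_cycleLattice hp) (cycleVector_ne_zero hp)
      (isConformalTo_cycleVector hcirc hpos)).symm⟩
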